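/- The inverse function 𝓗 : [b₀,∞) → [a₀,∞) of σ is continuously differentiable on (b₀,∞), strictly increasing, strictly convex, and superlinear: 𝓗(ρ)/ρ → +∞ as ρ → +∞. -/

import Mathlib

/-- The critical value `a₀ := max_{s∈[0,1]} min_{ρ∈ℝ} H(s,ρ)`. -/
noncomputable def a0 (H : ℝ → ℝ → ℝ) : ℝ :=
  sSup ((fun s => sInf (Set.range (H s))) '' Set.Icc (0 : ℝ) 1)

/-- `σ⁺_a(s) := max {ρ | H(s,ρ) = a}`. -/
noncomputable def sigmaPlus (H : ℝ → ℝ → ℝ) (a s : ℝ) : ℝ :=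
  sSup {ρ : ℝ | H s ρ = a}

/-- `σ(a) := ∫₀¹ σ⁺_a(s) ds`. -/
noncomputable def sigmaFn (H : ℝ → ℝ → ℝ) (a : ℝ) : ℝ :=
  ∫ s in (0 : ℝ)..1, sigmaPlus H a s

open Set Filter Topology MeasureTheory

/-- The largest point at which `f` takes the value `a`. -/
noncomputable def maxLevel (f : ℝ → ℝ) (a : ℝ) : ℝ :=
  sSup {ρ : ℝ | f ρ = a}

section maxLevel

variable {f : ℝ → ℝ} {A a : ℝ}

theorem isGreatest_maxLevel (hf : Continuous f) (hlim : Tendsto f (cocompact ℝ) atTop)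
    (hA : ∃ ρ, f ρ ≤ a) : IsGreatest {ρ | f ρ ≤ a} (maxLevel f a) ∧ f (maxLevel f a) = a := by
  have htop : Tendsto f atTop atTop := hlim.mono_left atTop_le_cocompact
  have hex : ∀ ρ, f ρ ≤ a → ∃ r, ρ ≤ r ∧ f r = a := by
    intro ρ hρ
    obtain ⟨t, ht, hρt⟩ := ((htop.eventually_ge_atTop a).and (eventually_ge_atTop ρ)).exists
    obtain ⟨r, hr, hra⟩ := intermediate_value_Icc hρt hf.continuousOn ⟨hρ, ht⟩
    exact ⟨r, hr.1, hra⟩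
  have hbdd : BddAbove {ρ | f ρ = a} := by
    obtain ⟨t, ht⟩ := eventually_atTop.1 (htop.eventually_gt_atTop a)
    refine ⟨t, fun ρ hρ => ?_⟩
    by_contra! h
    exact (ht ρ h.le).ne' hρ
  have hne : {ρ | f ρ = a}.Nonempty := by
    obtain ⟨ρ, hρ⟩ := hA
    obtain ⟨r, -, hr⟩ := hex ρ hρ
    exact ⟨r, hr⟩
  have hval : f (maxLevel f a) = a :=
    (isClosed_eq hf continuous_const).csSup_mem hne hbdd
  refine ⟨⟨hval.le, fun ρ hρ => ?_⟩, hval⟩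
  obtain ⟨r, hr, hra⟩ := hex ρ hρ
  exact hr.trans (le_csSup hbdd hra)

theorem strictMonoOn_maxLevel (hf : Continuous f) (hlim : Tendsto f (cocompact ℝ) atTop)
    (hA : ∃ ρ, f ρ ≤ A) : StrictMonoOn (maxLevel f) (Ici A) := by
  intro a ha b hb hab
  obtain ⟨ρ, hρ⟩ := hA
  have h₁ := isGreatest_maxLevel hf hlim ⟨ρ, hρ.trans ha⟩
  have h₂ := isGreatest_maxLevel hf hlim ⟨ρ, hρ.trans hb⟩
  refine lt_of_le_of_ne (h₂.1.2 (h₁.2.le.trans hab.le)) fun h => hab.ne ?_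
  rw [← h₁.2, h, h₂.2]

theorem strictConcaveOn_maxLevel (hf : Continuous f) (hlim : Tendsto f (cocompact ℝ) atTop)
    (hconv : StrictConvexOn ℝ univ f) (hA : ∃ ρ, f ρ ≤ A) :
    StrictConcaveOn ℝ (Ici A) (maxLevel f) := by
  refine ⟨convex_Ici A, fun x hx y hy hxy s t hs ht hst => ?_⟩
  have hz : s • x + t • y ∈ Ici A := convex_Ici A hx hy hs.le ht.le hst
  obtain ⟨ρ, hρ⟩ := hA
  have hgx := isGreatest_maxLevel hf hlim ⟨ρ, hρ.trans hx⟩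
  have hgy := isGreatest_maxLevel hf hlim ⟨ρ, hρ.trans hy⟩
  have hgz := isGreatest_maxLevel hf hlim ⟨ρ, hρ.trans hz⟩
  have hne := (strictMonoOn_maxLevel hf hlim ⟨ρ, hρ⟩).injOn.ne hx hy hxy
  have hlt := hconv.2 (mem_univ _) (mem_univ _) hne hs ht hst
  rw [hgx.2, hgy.2] at hlt
  refine lt_of_le_of_ne (hgz.1.2 hlt.le) fun h => ?_
  rw [h, hgz.2] at hlt
  exact hlt.false

theorem differentiableAt_maxLevel (hf : Differentiable ℝ f)
    (hlim : Tendsto f (cocompact ℝ) atTop)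
    (hconv : StrictConvexOn ℝ univ f) (hA : ∃ ρ, f ρ ≤ A) (ha : A < a) :
    DifferentiableAt ℝ (maxLevel f) a := by
  have hconc := strictConcaveOn_maxLevel hf.continuous hlim hconv hA
  have hcont : ContinuousAt (maxLevel f) a :=
    hconc.concaveOn.continuousOn_interior.continuousAt (by simpa using Ioi_mem_nhds ha)
  have hlt := strictMonoOn_maxLevel hf.continuous hlim hA self_mem_Ici ha.le ha
  have hinv : ∀ y ∈ Ici A, f (maxLevel f y) = y := fun y hy =>
    (isGreatest_maxLevel hf.continuous hlim (hA.imp fun _ h => h.trans hy)).2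
  have hpos : 0 < deriv f (maxLevel f a) := by
    refine lt_of_lt_of_le ?_ (hconv.convexOn.slope_le_deriv (mem_univ _) (mem_univ _) hlt
      hf.differentiableAt)
    rw [slope_def_field, hinv a ha.le, hinv A self_mem_Ici]
    exact div_pos (sub_pos.2 ha) (sub_pos.2 hlt)
  exact (HasDerivAt.of_local_left_inverse hcont hf.differentiableAt.hasDerivAt hpos.ne'
    (mem_of_superset (Ici_mem_nhds ha) hinv)).differentiableAt

end maxLevel

/-- The slopes of an increasing concave function are bounded away from the left endpoint. -/
theorem ConcaveOn.abs_slope_le {g : ℝ → ℝ} {A m B x y : ℝ} (hg : ConcaveOn ℝ (Ici A) g)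
    (hmono : MonotoneOn g (Ici A)) (hm : A < m) (hx : m ≤ x) (hy : m ≤ y) (hxy : x ≠ y)
    (hBx : g x - g A ≤ B) (hBy : g y - g A ≤ B) : |slope g x y| ≤ B / (m - A) := by
  wlog hlt : x < y generalizing x y
  · rw [slope_comm]
    exact this hy hx hxy.symm hBy hBx (lt_of_le_of_ne (not_lt.1 hlt) hxy.symm)
  have hAx : A < x := hm.trans_le hx
  have h₁ := hg.slope_anti_adjacent self_mem_Ici (hAx.trans hlt).le hAx hlt
  have h₂ : 0 ≤ g y - g x := sub_nonneg.2 (hmono hAx.le (hAx.trans hlt).le hlt.le)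
  have h₃ : 0 ≤ g x - g A := sub_nonneg.2 (hmono self_mem_Ici hAx.le hAx.le)
  rw [slope_def_field, abs_of_nonneg (div_nonneg h₂ (sub_pos.2 hlt).le)]
  refine h₁.trans ?_
  have : 0 < m - A := sub_pos.2 hm
  exact div_le_div₀ (h₃.trans hBx) hBx this (by linarith)

/-- The derivative of a differentiable convex function on an open set is continuous. -/
theorem ConvexOn.continuousOn_deriv_of_isOpen {f : ℝ → ℝ} {s : Set ℝ} (hf : ConvexOn ℝ s f)
    (hs : IsOpen s) (hd : ∀ x ∈ s, DifferentiableAt ℝ f x) : ContinuousOn (deriv f) s := by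
  intro x hx
  refine ContinuousAt.continuousWithinAt ?_
  have hmono := hf.monotoneOn_deriv hd
  have hord := hf.1.ordConnected.image_deriv hd
  have key : ∀ m ∈ s, ∀ b, deriv f m ≤ b → b < deriv f x → ∃ c ∈ s, b < deriv f c ∧
      deriv f c < deriv f x := by
    intro m hm b hmb hbx
    obtain ⟨d, hbd, hdx⟩ := exists_between hbx
    obtain ⟨c, hc, rfl⟩ := hord.out (mem_image_of_mem _ hm) (mem_image_of_mem _ hx)
      ⟨(hmb.trans_lt hbd).le, hdx.le⟩
    exact ⟨c, hc, hbd, hdx⟩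
  have key' : ∀ m ∈ s, ∀ b, b ≤ deriv f m → deriv f x < b → ∃ c ∈ s, deriv f x < deriv f c ∧
      deriv f c < b := by
    intro m hm b hmb hbx
    obtain ⟨d, hbd, hdx⟩ := exists_between hbx
    obtain ⟨c, hc, rfl⟩ := hord.out (mem_image_of_mem _ hx) (mem_image_of_mem _ hm)
      ⟨hbd.le, (hdx.trans_le hmb).le⟩
    exact ⟨c, hc, hbd, hdx⟩
  obtain ⟨l, u, hxlu, hlu⟩ := mem_nhds_iff_exists_Ioo_subset.1 (hs.mem_nhds hx)
  obtain ⟨p, hlp, hpx⟩ := exists_between hxlu.1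
  obtain ⟨q, hxq, hqu⟩ := exists_between hxlu.2
  have hp : p ∈ s := hlu ⟨hlp, hpx.trans hxlu.2⟩
  have hq : q ∈ s := hlu ⟨hxlu.1.trans hxq, hqu⟩
  refine tendsto_order.2 ⟨fun b hb => ?_, fun b hb => ?_⟩
  · obtain ⟨c, hc, hcx, hbc⟩ : ∃ c ∈ s, c < x ∧ b < deriv f c := by
      rcases lt_or_ge b (deriv f p) with h | h
      · exact ⟨p, hp, hpx, h⟩
      · obtain ⟨c, hc, hbc, hcx⟩ := key p hp b h hb
        exact ⟨c, hc, hmono.reflect_lt hc hx hcx, hbc⟩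
    filter_upwards [hs.mem_nhds hx, Ioi_mem_nhds hcx] with y hy hcy
    exact hbc.trans_le (hmono hc hy (le_of_lt hcy))
  · obtain ⟨c, hc, hcx, hbc⟩ : ∃ c ∈ s, x < c ∧ deriv f c < b := by
      rcases lt_or_ge (deriv f q) b with h | h
      · exact ⟨q, hq, hxq, h⟩
      · obtain ⟨c, hc, hcx, hbc⟩ := key' q hq b h hb
        exact ⟨c, hc, hmono.reflect_lt hx hc hcx, hbc⟩
    filter_upwards [hs.mem_nhds hx, Iio_mem_nhds hcx] with y hy hcy
    exact (hmono hy hc (le_of_lt hcy)).trans_lt hbc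

section family

variable {K : ℝ → ℝ → ℝ} {A a : ℝ}

theorem tendsto_cocompact_of_uniform (hK : ∀ C, ∃ R, ∀ s ρ, R ≤ |ρ| → C ≤ K s ρ) (s : ℝ) :
    Tendsto (K s) (cocompact ℝ) atTop := by
  refine tendsto_atTop.2 fun C => ?_
  obtain ⟨R, hR⟩ := hK C
  filter_upwards [(tendsto_norm_cocompact_atTop (E := ℝ)).eventually_ge_atTop R] with ρ hρ
  exact hR s ρ hρ

theorem exists_bound_maxLevel (hc : Continuous (Function.uncurry K))
    (hK : ∀ C, ∃ R, ∀ s ρ, R ≤ |ρ| → C ≤ K s ρ) (hA : ∀ s, ∃ ρ, K s ρ ≤ A) (a : ℝ) :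
    ∃ R, ∀ b ∈ Icc A a, ∀ s, |maxLevel (K s) b| ≤ R := by
  obtain ⟨R, hR⟩ := hK (a + 1)
  refine ⟨R, fun b hb s => ?_⟩
  by_contra! h
  have h₁ := hR s _ h.le
  rw [(isGreatest_maxLevel (hc.uncurry_left s) (tendsto_cocompact_of_uniform hK s)
    ((hA s).imp fun _ h => h.trans hb.1)).2] at h₁
  linarith [hb.2]

theorem measurable_maxLevel (hc : Continuous (Function.uncurry K))
    (hK : ∀ C, ∃ R, ∀ s ρ, R ≤ |ρ| → C ≤ K s ρ) (hA : ∀ s, ∃ ρ, K s ρ ≤ a) :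
    Measurable fun s => maxLevel (K s) a := by
  obtain ⟨R, hR⟩ := exists_bound_maxLevel hc hK hA a
  refine measurable_of_Ici fun r => IsClosed.measurableSet ?_
  rw [← isOpen_compl_iff, isOpen_iff_mem_nhds]
  intro s hs
  have hev : ∀ᶠ t in 𝓝 s, ∀ ρ ∈ Icc r R, a < K t ρ := by
    refine isCompact_Icc.eventually_forall_of_forall_eventually fun ρ hρ => ?_
    refine (hc.tendsto (s, ρ)).eventually (lt_mem_nhds ?_)
    by_contra! h
    exact hs (hρ.1.trans ((isGreatest_maxLevel (hc.uncurry_left s)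
      (tendsto_cocompact_of_uniform hK s) (hA s)).1.2 h))
  filter_upwards [hev] with t ht hmem
  refine (ht (maxLevel (K t) a) ⟨hmem, (le_abs_self _).trans (hR a ⟨le_rfl, le_rfl⟩ t)⟩).ne' ?_
  exact (isGreatest_maxLevel (hc.uncurry_left t) (tendsto_cocompact_of_uniform hK t) (hA t)).2

theorem intervalIntegrable_maxLevel (hc : Continuous (Function.uncurry K))
    (hK : ∀ C, ∃ R, ∀ s ρ, R ≤ |ρ| → C ≤ K s ρ) (hA : ∀ s, ∃ ρ, K s ρ ≤ a) :
    IntervalIntegrable (fun s => maxLevel (K s) a) volume 0 1 := by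
  obtain ⟨R, hR⟩ := exists_bound_maxLevel hc hK hA a
  refine (intervalIntegrable_const (c := R)).mono_fun
    (measurable_maxLevel hc hK hA).aestronglyMeasurable (ae_of_all _ fun s => ?_)
  exact (hR a ⟨le_rfl, le_rfl⟩ s).trans (le_abs_self R)

theorem strictMonoOn_integral_maxLevel (hc : Continuous (Function.uncurry K))
    (hK : ∀ C, ∃ R, ∀ s ρ, R ≤ |ρ| → C ≤ K s ρ) (hA : ∀ s, ∃ ρ, K s ρ ≤ A) :
    StrictMonoOn (fun a => ∫ s in (0 : ℝ)..1, maxLevel (K s) a) (Ici A) := by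
  intro a ha b hb hab
  have hi : ∀ c ∈ Ici A, IntervalIntegrable (fun s => maxLevel (K s) c) volume 0 1 := fun c hc' =>
    intervalIntegrable_maxLevel hc hK fun s => (hA s).imp fun _ h => h.trans hc'
  have := intervalIntegral.intervalIntegral_pos_of_pos ((hi b hb).sub (hi a ha))
    (fun s => sub_pos.2 (strictMonoOn_maxLevel (hc.uncurry_left s)
      (tendsto_cocompact_of_uniform hK s) (hA s) ha hb hab)) one_pos
  rw [intervalIntegral.integral_sub (hi b hb) (hi a ha)] at this
  exact sub_pos.1 this

theorem strictConcaveOn_integral_maxLevel (hc : Continuous (Function.uncurry K))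
    (hconv : ∀ s, StrictConvexOn ℝ univ (K s))
    (hK : ∀ C, ∃ R, ∀ s ρ, R ≤ |ρ| → C ≤ K s ρ) (hA : ∀ s, ∃ ρ, K s ρ ≤ A) :
    StrictConcaveOn ℝ (Ici A) (fun a => ∫ s in (0 : ℝ)..1, maxLevel (K s) a) := by
  refine ⟨convex_Ici A, fun x hx y hy hxy p q hp hq hpq => ?_⟩
  have hz : p • x + q • y ∈ Ici A := convex_Ici A hx hy hp.le hq.le hpq
  have hi : ∀ c ∈ Ici A, IntervalIntegrable (fun s => maxLevel (K s) c) volume 0 1 := fun c hc' =>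
    intervalIntegrable_maxLevel hc hK fun s => (hA s).imp fun _ h => h.trans hc'
  have hpx := (hi x hx).const_mul p
  have hqy := (hi y hy).const_mul q
  have := intervalIntegral.intervalIntegral_pos_of_pos ((hi _ hz).sub (hpx.add hqy))
    (fun s => sub_pos.2 ((strictConcaveOn_maxLevel (hc.uncurry_left s)
      (tendsto_cocompact_of_uniform hK s) (hconv s) (hA s)).2 hx hy hxy hp hq hpq)) one_pos
  rw [intervalIntegral.integral_sub (hi _ hz) (hpx.add hqy),
    intervalIntegral.integral_add hpx hqy, intervalIntegral.integral_const_mul,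
    intervalIntegral.integral_const_mul] at this
  exact sub_pos.1 this

theorem differentiableAt_integral_maxLevel (hc : Continuous (Function.uncurry K))
    (hd : ∀ s, Differentiable ℝ (K s)) (hconv : ∀ s, StrictConvexOn ℝ univ (K s))
    (hK : ∀ C, ∃ R, ∀ s ρ, R ≤ |ρ| → C ≤ K s ρ) (hA : ∀ s, ∃ ρ, K s ρ ≤ A) (ha : A < a) :
    DifferentiableAt ℝ (fun a => ∫ s in (0 : ℝ)..1, maxLevel (K s) a) a := by
  have hi : ∀ c ∈ Ici A, IntervalIntegrable (fun s => maxLevel (K s) c) volume 0 1 := fun c hc' =>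
    intervalIntegrable_maxLevel hc hK fun s => (hA s).imp fun _ h => h.trans hc'
  have hmeas : ∀ c ∈ Ici A, Measurable fun s => maxLevel (K s) c := fun c hc' =>
    measurable_maxLevel hc hK fun s => (hA s).imp fun _ h => h.trans hc'
  obtain ⟨R, hR⟩ := exists_bound_maxLevel hc hK hA (a + 1)
  obtain ⟨m, hAm, hma⟩ := exists_between ha
  have hnear : ∀ᶠ b in 𝓝[≠] a, b ∈ Ioo m (a + 1) :=
    mem_nhdsWithin_of_mem_nhds (Ioo_mem_nhds hma (lt_add_one a))
  suffices HasDerivAt (fun a => ∫ s in (0 : ℝ)..1, maxLevel (K s) a)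
      (∫ s in (0 : ℝ)..1, deriv (maxLevel (K s)) a) a from this.differentiableAt
  rw [hasDerivAt_iff_tendsto_slope]
  have hlim : Tendsto (fun b => ∫ s in (0 : ℝ)..1, slope (maxLevel (K s)) a b) (𝓝[≠] a)
      (𝓝 (∫ s in (0 : ℝ)..1, deriv (maxLevel (K s)) a)) := by
    refine intervalIntegral.tendsto_integral_filter_of_dominated_convergence
      (fun _ => (R + R) / (m - A)) ?_ ?_ intervalIntegrable_const ?_
    · filter_upwards [hnear] with b hb
      simp only [slope_def_field]
      exact (((hmeas b (hAm.trans hb.1).le).sub (hmeas a ha.le)).div_const _).aestronglyMeasurable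
    · filter_upwards [hnear, self_mem_nhdsWithin] with b hb hba
      refine ae_of_all _ fun s _ => ?_
      have hB : ∀ c, A ≤ c → c ≤ a + 1 → maxLevel (K s) c - maxLevel (K s) A ≤ R + R := by
        intro c hc₁ hc₂
        have h₁ := (abs_le.1 (hR c ⟨hc₁, hc₂⟩ s)).2
        have h₂ := (abs_le.1 (hR A ⟨le_rfl, hc₁.trans hc₂⟩ s)).1
        linarith
      exact (strictConcaveOn_maxLevel (hc.uncurry_left s) (tendsto_cocompact_of_uniform hK s)
        (hconv s) (hA s)).concaveOn.abs_slope_le (strictMonoOn_maxLevel (hc.uncurry_left s)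
        (tendsto_cocompact_of_uniform hK s) (hA s)).monotoneOn hAm hma.le hb.1.le (Ne.symm hba)
        (hB a ha.le (lt_add_one a).le) (hB b (hAm.trans hb.1).le hb.2.le)
    · refine ae_of_all _ fun s _ => ?_
      exact hasDerivAt_iff_tendsto_slope.1 (differentiableAt_maxLevel (hd s)
        (tendsto_cocompact_of_uniform hK s) (hconv s) (hA s) ha).hasDerivAt
  refine hlim.congr' ?_
  filter_upwards [hnear] with b hb
  simp only [slope_def_field]
  rw [intervalIntegral.integral_div,
    intervalIntegral.integral_sub (hi b (hAm.trans hb.1).le) (hi a ha.le)]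

theorem exists_integral_maxLevel_le (hc : Continuous (Function.uncurry K))
    (hK : ∀ C, ∃ R, ∀ s ρ, R ≤ |ρ| → C ≤ K s ρ) (hA : ∀ s, ∃ ρ, K s ρ ≤ A)
    (hsup : ∀ C : ℝ, ∃ R : ℝ, ∀ s ρ : ℝ, R ≤ |ρ| → C ≤ K s ρ / |ρ|) {C : ℝ} (hC : 0 < C) :
    ∃ R, ∀ a ∈ Ici A, ∫ s in (0 : ℝ)..1, maxLevel (K s) a ≤ max R (a / C) := by
  obtain ⟨R, hR⟩ := hsup C
  refine ⟨max R 0, fun a ha => ?_⟩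
  have hA' : ∀ s, ∃ ρ, K s ρ ≤ a := fun s => (hA s).imp fun _ h => h.trans ha
  have hle : ∀ s, maxLevel (K s) a ≤ max (max R 0) (a / C) := by
    intro s
    by_contra! h
    obtain ⟨h₁, h₂⟩ := max_lt_iff.1 h
    obtain ⟨h₃, h₄⟩ := max_lt_iff.1 h₁
    have h₅ := hR s _ (h₃.le.trans (le_abs_self _))
    rw [(isGreatest_maxLevel (hc.uncurry_left s) (tendsto_cocompact_of_uniform hK s) (hA' s)).2,
      abs_of_pos h₄, le_div_iff₀ h₄] at h₅
    rw [div_lt_iff₀ hC] at h₂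
    linarith
  have := intervalIntegral.integral_mono_on zero_le_one (intervalIntegrable_maxLevel hc hK hA')
    intervalIntegrable_const fun s _ => hle s
  simpa using this

end family

section inverse

variable {σ φ : ℝ → ℝ} {A : ℝ}

theorem strictMonoOn_of_inverse (hσ : StrictMonoOn σ (Ici A))
    (hinv : ∀ ρ ∈ Ici (σ A), σ (φ ρ) = ρ) (hmaps : ∀ ρ ∈ Ici (σ A), φ ρ ∈ Ici A) :
    StrictMonoOn φ (Ici (σ A)) := by
  intro x hx y hy hxy
  rwa [← hσ.lt_iff_lt (hmaps x hx) (hmaps y hy), hinv x hx, hinv y hy]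

theorem strictConvexOn_of_inverse (hσ : StrictMonoOn σ (Ici A))
    (hconc : StrictConcaveOn ℝ (Ici A) σ)
    (hinv : ∀ ρ ∈ Ici (σ A), σ (φ ρ) = ρ) (hmaps : ∀ ρ ∈ Ici (σ A), φ ρ ∈ Ici A) :
    StrictConvexOn ℝ (Ici (σ A)) φ := by
  refine ⟨convex_Ici _, fun x hx y hy hxy p q hp hq hpq => ?_⟩
  have hz : p • x + q • y ∈ Ici (σ A) := convex_Ici _ hx hy hp.le hq.le hpq
  have hw : p • φ x + q • φ y ∈ Ici A :=
    convex_Ici _ (hmaps x hx) (hmaps y hy) hp.le hq.le hpq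
  have hne := (strictMonoOn_of_inverse hσ hinv hmaps).injOn.ne hx hy hxy
  have := hconc.2 (hmaps x hx) (hmaps y hy) hne hp hq hpq
  rwa [hinv x hx, hinv y hy, ← hinv _ hz, hσ.lt_iff_lt (hmaps _ hz) hw] at this

theorem differentiableAt_of_inverse (hσ : StrictMonoOn σ (Ici A))
    (hconc : StrictConcaveOn ℝ (Ici A) σ) (hd : ∀ a ∈ Ioi A, DifferentiableAt ℝ σ a)
    (hinv : ∀ ρ ∈ Ici (σ A), σ (φ ρ) = ρ) (hmaps : ∀ ρ ∈ Ici (σ A), φ ρ ∈ Ici A)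
    {ρ : ℝ} (hρ : σ A < ρ) : DifferentiableAt ℝ φ ρ := by
  have hcont : ContinuousAt φ ρ :=
    (strictConvexOn_of_inverse hσ hconc hinv hmaps).convexOn.continuousOn_interior.continuousAt
      (by simpa using Ioi_mem_nhds hρ)
  have hA : A < φ ρ := by
    rwa [← hσ.lt_iff_lt self_mem_Ici (hmaps ρ hρ.le), hinv ρ hρ.le]
  have hpos : 0 < deriv σ (φ ρ) := by
    have hlt := lt_add_one (φ ρ)
    refine lt_of_lt_of_le ?_ (hconc.concaveOn.slope_le_deriv hA.le (hA.trans hlt).le hlt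
      (hd _ hA))
    rw [slope_def_field]
    exact div_pos (sub_pos.2 (hσ hA.le (hA.trans hlt).le hlt)) (sub_pos.2 hlt)
  exact (HasDerivAt.of_local_left_inverse hcont (hd _ hA).hasDerivAt hpos.ne'
    (mem_of_superset (Ici_mem_nhds hρ) hinv)).differentiableAt

theorem tendsto_div_atTop_of_inverse
    (hbound : ∀ C : ℝ, 0 < C → ∃ R, ∀ a ∈ Ici A, σ a ≤ max R (a / C))
    (hinv : ∀ ρ ∈ Ici (σ A), σ (φ ρ) = ρ) (hmaps : ∀ ρ ∈ Ici (σ A), φ ρ ∈ Ici A) :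
    Tendsto (fun ρ => φ ρ / ρ) atTop atTop := by
  refine tendsto_atTop.2 fun C => ?_
  have hC : 0 < max C 1 := lt_max_of_lt_right one_pos
  obtain ⟨R, hR⟩ := hbound _ hC
  filter_upwards [eventually_gt_atTop R, eventually_gt_atTop 0, eventually_ge_atTop (σ A)]
    with ρ h₁ h₂ h₃
  have h := hR _ (hmaps ρ h₃)
  rw [hinv ρ h₃, le_max_iff, or_iff_right h₁.not_ge, le_div_iff₀ hC] at h
  rw [le_div_iff₀ h₂]
  nlinarith [le_max_left C 1]

end inverse

theorem exists_le_a0 {H : ℝ → ℝ → ℝ}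
    (hHcont : ContinuousOn (fun p : ℝ × ℝ => H p.1 p.2) (Icc (0 : ℝ) 1 ×ˢ (univ : Set ℝ)))
    (hH : ∀ s ∈ Icc (0 : ℝ) 1, Continuous (H s))
    (hlim : ∀ s ∈ Icc (0 : ℝ) 1, Tendsto (H s) (cocompact ℝ) atTop)
    {s : ℝ} (hs : s ∈ Icc (0 : ℝ) 1) : ∃ ρ, H s ρ ≤ a0 H := by
  have hmin : ∀ t ∈ Icc (0 : ℝ) 1, ∃ ρ, IsLeast (range (H t)) (H t ρ) := by
    intro t ht
    obtain ⟨ρ, hρ⟩ := (hH t ht).exists_forall_le (hlim t ht)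
    exact ⟨ρ, mem_range_self ρ, forall_mem_range.2 hρ⟩
  have hcont : ContinuousOn (fun t => H t 0) (Icc (0 : ℝ) 1) :=
    hHcont.comp (f := fun t : ℝ => (t, (0 : ℝ))) (by fun_prop) fun t ht => ⟨ht, mem_univ _⟩
  obtain ⟨B, hB⟩ := isCompact_Icc.bddAbove_image hcont
  obtain ⟨ρ, hρ⟩ := hmin s hs
  refine ⟨ρ, ?_⟩
  rw [← hρ.csInf_eq]
  refine le_csSup ⟨B, forall_mem_image.2 fun t ht => ?_⟩ (mem_image_of_mem _ hs)
  obtain ⟨r, hr⟩ := hmin t ht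
  exact (csInf_le hr.bddBelow (mem_range_self 0)).trans (hB (mem_image_of_mem _ ht))

/-- the inverse function `𝓗 : [b₀,∞) → [a₀,∞)` of `σ` is
continuously differentiable on `(b₀,∞)`, strictly increasing, strictly convex,
and superlinear. -/
theorem stmt14 (H : ℝ → ℝ → ℝ)
    (hHcont : ContinuousOn (fun p : ℝ × ℝ => H p.1 p.2)
      (Set.Icc (0 : ℝ) 1 ×ˢ (Set.univ : Set ℝ)))
    (hHdiff : ∀ s ∈ Set.Icc (0 : ℝ) 1, ContDiff ℝ 1 (H s))
    (hHconv : ∀ s ∈ Set.Icc (0 : ℝ) 1, StrictConvexOn ℝ (Set.univ : Set ℝ) (H s))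
    (hHsup : ∀ C : ℝ, ∃ R : ℝ, ∀ s ∈ Set.Icc (0 : ℝ) 1, ∀ ρ : ℝ,
      R ≤ |ρ| → C ≤ H s ρ / |ρ|)
    (𝓗 : ℝ → ℝ)
    (h𝓗₁ : ∀ a ∈ Set.Ici (a0 H), 𝓗 (sigmaFn H a) = a)
    (h𝓗₂ : ∀ ρ ∈ Set.Ici (sigmaFn H (a0 H)), sigmaFn H (𝓗 ρ) = ρ)
    (h𝓗₃ : ∀ ρ ∈ Set.Ici (sigmaFn H (a0 H)), 𝓗 ρ ∈ Set.Ici (a0 H)) :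
    StrictMonoOn 𝓗 (Set.Ici (sigmaFn H (a0 H))) ∧
    StrictConvexOn ℝ (Set.Ici (sigmaFn H (a0 H))) 𝓗 ∧
    (∀ ρ ∈ Set.Ioi (sigmaFn H (a0 H)), DifferentiableAt ℝ 𝓗 ρ) ∧
    ContinuousOn (deriv 𝓗) (Set.Ioi (sigmaFn H (a0 H))) ∧
    Filter.Tendsto (fun ρ => 𝓗 ρ / ρ) Filter.atTop Filter.atTop := by
  have hproj : ∀ s, (projIcc (0 : ℝ) 1 zero_le_one s : ℝ) ∈ Set.Icc (0 : ℝ) 1 := fun s =>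
    (projIcc (0 : ℝ) 1 zero_le_one s).2
  let K : ℝ → ℝ → ℝ := fun s => H (projIcc (0 : ℝ) 1 zero_le_one s)
  have hc : Continuous (Function.uncurry K) := by
    refine hHcont.comp_continuous
      (f := fun p : ℝ × ℝ => ((projIcc (0 : ℝ) 1 zero_le_one p.1 : ℝ), p.2)) ?_
      fun p => ⟨hproj p.1, mem_univ _⟩
    exact (continuous_subtype_val.comp (continuous_projIcc.comp continuous_fst)).prodMk
      continuous_snd
  have hd : ∀ s, Differentiable ℝ (K s) := fun s => (hHdiff _ (hproj s)).differentiable one_ne_zero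
  have hconv : ∀ s, StrictConvexOn ℝ univ (K s) := fun s => hHconv _ (hproj s)
  have hsup : ∀ C : ℝ, ∃ R : ℝ, ∀ s ρ : ℝ, R ≤ |ρ| → C ≤ K s ρ / |ρ| := fun C =>
    (hHsup C).imp fun R hR s => hR _ (hproj s)
  have hK : ∀ C, ∃ R, ∀ s ρ, R ≤ |ρ| → C ≤ K s ρ := by
    intro C
    obtain ⟨R, hR⟩ := hsup (max C 0)
    refine ⟨max R 1, fun s ρ hρ => ?_⟩
    have h₁ : 1 ≤ |ρ| := (le_max_right _ _).trans hρ
    have h₂ := hR s ρ ((le_max_left _ _).trans hρ)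
    rw [le_div_iff₀ (one_pos.trans_le h₁)] at h₂
    exact (le_max_left C 0).trans ((le_mul_of_one_le_right (le_max_right C 0) h₁).trans h₂)
  have hKH : ∀ s ∈ Set.Icc (0 : ℝ) 1, K s = H s := fun s hs => by
    simp only [K, projIcc_of_mem zero_le_one hs]
  have hA : ∀ s, ∃ ρ, K s ρ ≤ a0 H := fun s =>
    exists_le_a0 hHcont (fun t ht => (hHdiff t ht).continuous)
      (fun t ht => hKH t ht ▸ tendsto_cocompact_of_uniform hK t) (hproj s)
  have hσ : sigmaFn H = fun a => ∫ s in (0 : ℝ)..1, maxLevel (K s) a := by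
    funext a
    refine intervalIntegral.integral_congr fun s hs => ?_
    rw [uIcc_of_le zero_le_one] at hs
    simp only [hKH s hs]
    rfl
  have hmono := strictMonoOn_integral_maxLevel hc hK hA
  have hconc := strictConcaveOn_integral_maxLevel hc hconv hK hA
  have hdiff := fun a (ha : a ∈ Ioi (a0 H)) =>
    differentiableAt_integral_maxLevel hc hd hconv hK hA ha
  have hbound := fun C (hC : (0 : ℝ) < C) => exists_integral_maxLevel_le hc hK hA hsup hC
  rw [← hσ] at hmono hconc hdiff
  have hderiv : ∀ ρ ∈ Set.Ioi (sigmaFn H (a0 H)), DifferentiableAt ℝ 𝓗 ρ := fun ρ hρ =>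
    differentiableAt_of_inverse hmono hconc hdiff h𝓗₂ h𝓗₃ hρ
  have hcvx := strictConvexOn_of_inverse hmono hconc h𝓗₂ h𝓗₃
  refine ⟨strictMonoOn_of_inverse hmono h𝓗₂ h𝓗₃, hcvx, hderiv, ?_, ?_⟩
  · exact (hcvx.convexOn.subset Ioi_subset_Ici_self (convex_Ioi _)).continuousOn_deriv_of_isOpen
      isOpen_Ioi hderiv
  · exact tendsto_div_atTop_of_inverse (by rwa [hσ]) h𝓗₂ h𝓗₃
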